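/- arXiv:1611.01103 — 2 statements merged into one kernel-verified Lean document; each statement's English description precedes it below -/
import Mathlib

section
/- Let M = T₁×⋯×T_k be a direct product of pairwise isomorphic nonabelian simple groups, let G₀ be a group of automorphisms of M whose induced action on the set {T₁,…,T_k} of direct factors is transitive, and let 𝒦 = {K₁,…,K_ℓ} be a G₀-invariant abstract cartesian factorisation of M; set M₀ = K₁ ∩ ⋯ ∩ K_ℓ. Suppose there exist two nontrivial full strips X₁ and X₂, involved in members of 𝒦, whose supports intersect nontrivially (Supp X₁ ∩ Supp X₂ ≠ ∅). Then both of the following hold: (1) T₁ admits a uniform automorphism; (2) M₀ is not a subdirect subgroup of M. -/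
open scoped Pointwise

/-- A subgroup `X` of `M = T₁ × ⋯ × T_k` is a full strip with support `S`: there is
`i₀ ∈ S` and isomorphisms `φ i : T i₀ ≃* T i` with `φ i₀ = id` such that `X` consists
of the tuples `f` with `f i = φ i t` for `i ∈ S` (single `t ∈ T i₀`) and `f i = 1`
for `i ∉ S`. -/
def IsFullStrip {k : ℕ} (T : Fin k → Type*) [∀ i, Group (T i)]
    (X : Subgroup (∀ i, T i)) (S : Finset (Fin k)) : Prop :=
  ∃ (i₀ : Fin k) (_ : i₀ ∈ S) (φ : ∀ i, T i₀ ≃* T i), φ i₀ = MulEquiv.refl (T i₀) ∧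
    (X : Set (∀ i, T i)) =
      {f | ∃ t : T i₀, ∀ i, (i ∈ S → f i = φ i t) ∧ (i ∉ S → f i = 1)}

/-- A strip `X` with support `S` is involved in a subgroup `K` of `M = T₁ × ⋯ × T_k`
if `K = X × σ_{𝒯∖S}(K)`, i.e. `K` consists exactly of the elements whose restriction
to `S` lies in `X` and whose restriction off `S` agrees with some element of `K`. -/
def StripInvolvedIn {k : ℕ} (T : Fin k → Type*) [∀ i, Group (T i)]
    (X K : Subgroup (∀ i, T i)) (S : Finset (Fin k)) : Prop :=
  (K : Set (∀ i, T i)) =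
    {g | (fun i => if i ∈ S then g i else 1) ∈ X ∧ ∃ f ∈ K, ∀ i ∉ S, g i = f i}

/-- The `i`-th direct factor of `M = T₁ × ⋯ × T_k`, i.e. the subgroup of tuples that
are trivial in every coordinate other than `i`. -/
def factorSubgroup {k : ℕ} (T : Fin k → Type*) [∀ i, Group (T i)] (i : Fin k) :
    Subgroup (∀ j, T j) :=
  Subgroup.pi ({i}ᶜ : Set (Fin k)) fun _ => ⊥

/-- In a finite hypergraph in which no vertex and no edge is a dead end, some edge has two
distinct vertices that are joined by a chain of other edges. -/
theorem exists_joined_by_other_edges {V E : Type*} [Finite V] (inc : V → E → Prop)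
    (hv : ∀ v e, ∃ e', e' ≠ e ∧ inc v e') (he : ∀ v e, inc v e → ∃ v', v' ≠ v ∧ inc v' e)
    (v₀ : V) (e₀ : E) :
    ∃ e i j, i ≠ j ∧ inc i e ∧ inc j e ∧
      Relation.ReflTransGen (fun a b => ∃ f, f ≠ e ∧ inc a f ∧ inc b f) i j := by
  by_contra! hno
  let C (i : V) (e : E) : Set V :=
    {j | Relation.ReflTransGen (fun a b => ∃ f, f ≠ e ∧ inc a f ∧ inc b f) i j}
  have hdesc : ∀ n i e, inc i e → (C i e).ncard = n → False := by
    intro n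
    induction n using Nat.strong_induction_on with
    | _ n ih =>
      intro i e hie hn
      obtain ⟨e', hne, hie'⟩ := hv i e
      obtain ⟨j, hji, hje'⟩ := he i e' hie'
      have hi : i ∉ C j e' := hno e' j i hji hje' hie'
      have hsub : C j e' ⊆ C i e := by
        intro q hq
        induction hq with
        | refl => exact Relation.ReflTransGen.single ⟨e', hne, hie', hje'⟩
        | @tail b c hb hbc ihb =>
          obtain ⟨f, hf, hbf, hcf⟩ := hbc
          refine Relation.ReflTransGen.tail ihb ⟨f, ?_, hbf, hcf⟩
          rintro rfl
          by_cases hib : i = b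
          · subst hib
            exact hi hb
          · exact hno f i b hib hie hbf ihb
      have hlt : (C j e').ncard < (C i e).ncard :=
        Set.ncard_lt_ncard ⟨hsub, fun h => hi (h Relation.ReflTransGen.refl)⟩ (Set.toFinite _)
      exact ih _ (hn ▸ hlt) j e' hje' rfl
  obtain ⟨e, -, h⟩ := hv v₀ e₀
  exact hdesc _ v₀ e h rfl

theorem IsSimpleGroup.eq_one_of_forall_commute {G : Type*} [Group G] [IsSimpleGroup G]
    (hG : ∃ a b : G, a * b ≠ b * a) {z : G} (hz : ∀ x, x * z = z * x) : z = 1 := by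
  have hmem : z ∈ Subgroup.center G := Subgroup.mem_center_iff.mpr hz
  rcases (inferInstance : (Subgroup.center G).Normal).eq_bot_or_eq_top with h | h
  · simpa [h] using hmem
  · obtain ⟨a, b, hab⟩ := hG
    have hb : b ∈ Subgroup.center G := h ▸ Subgroup.mem_top b
    exact absurd (Subgroup.mem_center_iff.mp hb a) hab

section Strips

variable {k : ℕ} {T : Fin k → Type*} [∀ i, Group (T i)]

/-- Every element of `K` has its `j`-th coordinate determined by its `i`-th coordinate through
a fixed isomorphism. -/
def CoordsLinked (K : Subgroup (∀ i, T i)) (i j : Fin k) : Prop :=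
  ∃ φ : T i ≃* T j, ∀ f ∈ K, f j = φ (f i)

theorem CoordsLinked.refl (K : Subgroup (∀ i, T i)) (i : Fin k) : CoordsLinked K i i :=
  ⟨MulEquiv.refl _, fun _ _ => rfl⟩

theorem CoordsLinked.symm {K : Subgroup (∀ i, T i)} {i j : Fin k} (h : CoordsLinked K i j) :
    CoordsLinked K j i := by
  obtain ⟨φ, hφ⟩ := h
  exact ⟨φ.symm, fun f hf => by simp [hφ f hf]⟩

theorem CoordsLinked.trans {K : Subgroup (∀ i, T i)} {i j l : Fin k} (h : CoordsLinked K i j)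
    (h' : CoordsLinked K j l) : CoordsLinked K i l := by
  obtain ⟨φ, hφ⟩ := h
  obtain ⟨ψ, hψ⟩ := h'
  exact ⟨φ.trans ψ, fun f hf => by simp [hφ f hf, hψ f hf]⟩

theorem CoordsLinked.setOf_eq {K : Subgroup (∀ i, T i)} {i j : Fin k} (h : CoordsLinked K i j) :
    {l | CoordsLinked K i l} = {l | CoordsLinked K j l} :=
  Set.ext fun _ => ⟨h.symm.trans, h.trans⟩

theorem IsFullStrip.mem_iff {X : Subgroup (∀ i, T i)} {S : Finset (Fin k)} {i₀ : Fin k}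
    {φ : ∀ i, T i₀ ≃* T i}
    (h : (X : Set (∀ i, T i)) =
      {f | ∃ t : T i₀, ∀ i, (i ∈ S → f i = φ i t) ∧ (i ∉ S → f i = 1)}) (f : ∀ i, T i) :
    f ∈ X ↔ ∃ t : T i₀, ∀ i, (i ∈ S → f i = φ i t) ∧ (i ∉ S → f i = 1) := by
  rw [← SetLike.mem_coe, h, Set.mem_ofPred_eq]

theorem StripInvolvedIn.mem_iff {X K : Subgroup (∀ i, T i)} {S : Finset (Fin k)}
    (h : StripInvolvedIn T X K S) (g : ∀ i, T i) :
    g ∈ K ↔ (fun i => if i ∈ S then g i else 1) ∈ X ∧ ∃ f ∈ K, ∀ i ∉ S, g i = f i := by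
  rw [← SetLike.mem_coe, h, Set.mem_ofPred_eq]

theorem IsFullStrip.coordsLinked {X : Subgroup (∀ i, T i)} {S : Finset (Fin k)}
    (h : IsFullStrip T X S) {i j : Fin k} (hi : i ∈ S) (hj : j ∈ S) : CoordsLinked X i j := by
  obtain ⟨i₀, -, φ, -, hX⟩ := h
  refine ⟨(φ i).symm.trans (φ j), fun f hf => ?_⟩
  obtain ⟨t, ht⟩ := (IsFullStrip.mem_iff hX f).mp hf
  simp [(ht i).1 hi, (ht j).1 hj]

theorem IsFullStrip.eq_one_of_notMem {X : Subgroup (∀ i, T i)} {S : Finset (Fin k)}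
    (h : IsFullStrip T X S) {f : ∀ i, T i} (hf : f ∈ X) {i : Fin k} (hi : i ∉ S) : f i = 1 := by
  obtain ⟨i₀, -, φ, -, hX⟩ := h
  obtain ⟨t, ht⟩ := (IsFullStrip.mem_iff hX f).mp hf
  exact (ht i).2 hi

theorem IsFullStrip.exists_mem_ne_one {X : Subgroup (∀ i, T i)} {S : Finset (Fin k)}
    (h : IsFullStrip T X S) {i : Fin k} [Nontrivial (T i)] (hi : i ∈ S) :
    ∃ f ∈ X, f i ≠ 1 := by
  obtain ⟨i₀, -, φ, -, hX⟩ := h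
  obtain ⟨t, ht⟩ := exists_ne (1 : T i)
  refine ⟨fun l => if l ∈ S then φ l ((φ i).symm t) else 1,
    (IsFullStrip.mem_iff hX _).mpr ⟨(φ i).symm t, fun l => ⟨fun hl => by simp [hl],
      fun hl => by simp [hl]⟩⟩, ?_⟩
  simpa [hi] using ht

/-- Restricting an element of a strip to a set containing its support changes nothing. -/
theorem IsFullStrip.restrict_eq_self {X : Subgroup (∀ i, T i)} {S S' : Finset (Fin k)}
    (h : IsFullStrip T X S) (hS : S ⊆ S') {f : ∀ i, T i} (hf : f ∈ X) :
    (fun i => if i ∈ S' then f i else 1) = f := by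
  funext i
  by_cases hi : i ∈ S'
  · simp [hi]
  · simp [hi, h.eq_one_of_notMem hf fun h' => hi (hS h')]

theorem StripInvolvedIn.le {X K : Subgroup (∀ i, T i)} {S : Finset (Fin k)}
    (h : StripInvolvedIn T X K S) (hX : IsFullStrip T X S) : X ≤ K := fun f hf =>
  (h.mem_iff f).mpr ⟨by rwa [hX.restrict_eq_self subset_rfl hf],
    1, K.one_mem, fun i hi => hX.eq_one_of_notMem hf hi⟩

theorem StripInvolvedIn.coordsLinked {X K : Subgroup (∀ i, T i)} {S : Finset (Fin k)}
    (h : StripInvolvedIn T X K S) (hX : IsFullStrip T X S) {i j : Fin k} (hi : i ∈ S)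
    (hj : j ∈ S) : CoordsLinked K i j := by
  obtain ⟨φ, hφ⟩ := hX.coordsLinked hi hj
  refine ⟨φ, fun f hf => ?_⟩
  simpa [hi, hj] using hφ _ ((h.mem_iff f).mp hf).1

theorem StripInvolvedIn.support_subset {X₁ X₂ K : Subgroup (∀ i, T i)} {S₁ S₂ : Finset (Fin k)}
    (h₁ : StripInvolvedIn T X₁ K S₁) (h₂ : StripInvolvedIn T X₂ K S₂)
    (hX₁ : IsFullStrip T X₁ S₁) (hX₂ : IsFullStrip T X₂ S₂) {i : Fin k} [Nontrivial (T i)]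
    (hi₁ : i ∈ S₁) (hi₂ : i ∈ S₂) : S₁ ⊆ S₂ := by
  intro j hj
  by_contra hj₂
  obtain ⟨f, hf, hfi⟩ := hX₂.exists_mem_ne_one hi₂
  obtain ⟨φ, hφ⟩ := h₁.coordsLinked hX₁ hi₁ hj
  have hfj := hφ f (h₂.le hX₂ hf)
  rw [hX₂.eq_one_of_notMem hf hj₂, eq_comm, EmbeddingLike.map_eq_one_iff] at hfj
  exact hfi hfj

theorem StripInvolvedIn.strip_le {X₁ X₂ K : Subgroup (∀ i, T i)} {S₁ S₂ : Finset (Fin k)}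
    (h₁ : StripInvolvedIn T X₁ K S₁) (h₂ : StripInvolvedIn T X₂ K S₂)
    (hX₂ : IsFullStrip T X₂ S₂) (hS : S₂ ⊆ S₁) : X₂ ≤ X₁ := fun f hf => by
  simpa only [hX₂.restrict_eq_self hS hf] using ((h₁.mem_iff f).mp (h₂.le hX₂ hf)).1

/-- Two full strips involved in the same subgroup coincide if their supports meet. -/
theorem StripInvolvedIn.strip_eq {X₁ X₂ K : Subgroup (∀ i, T i)} {S₁ S₂ : Finset (Fin k)}
    (h₁ : StripInvolvedIn T X₁ K S₁) (h₂ : StripInvolvedIn T X₂ K S₂)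
    (hX₁ : IsFullStrip T X₁ S₁) (hX₂ : IsFullStrip T X₂ S₂) {i : Fin k} [Nontrivial (T i)]
    (hi₁ : i ∈ S₁) (hi₂ : i ∈ S₂) : X₁ = X₂ :=
  le_antisymm (h₂.strip_le h₁ hX₁ (h₁.support_subset h₂ hX₁ hX₂ hi₁ hi₂))
    (h₁.strip_le h₂ hX₂ (h₂.support_subset h₁ hX₂ hX₁ hi₂ hi₁))

theorem mem_factorSubgroup {i : Fin k} {f : ∀ j, T j} :
    f ∈ factorSubgroup T i ↔ ∀ j, j ≠ i → f j = 1 := by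
  simp [factorSubgroup, Subgroup.mem_pi]

theorem mulSingle_mem_factorSubgroup (i : Fin k) (t : T i) :
    Pi.mulSingle i t ∈ factorSubgroup T i :=
  mem_factorSubgroup.mpr fun _ hj => Pi.mulSingle_eq_of_ne hj t

theorem mulSingle_apply_of_mem_factorSubgroup {i : Fin k} {f : ∀ j, T j}
    (hf : f ∈ factorSubgroup T i) : Pi.mulSingle i (f i) = f := by
  funext j
  by_cases h : j = i
  · subst h
    simp
  · rw [Pi.mulSingle_eq_of_ne h, mem_factorSubgroup.mp hf j h]

theorem factorSubgroup_injective [∀ i, Nontrivial (T i)] :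
    Function.Injective (factorSubgroup T) := by
  intro i j hij
  by_contra hne
  obtain ⟨t, ht⟩ := exists_ne (1 : T i)
  have := mem_factorSubgroup.mp (hij ▸ mulSingle_mem_factorSubgroup i t) i hne
  exact ht (by simpa using this)

/-- An automorphism carrying the `i`-th factor to the `i'`-th one acts on that coordinate
through an isomorphism of the factors. -/
theorem exists_mulEquiv_apply_eq [∀ i, IsSimpleGroup (T i)]
    (hnonab : ∀ i, ∃ a b : T i, a * b ≠ b * a) (g : MulAut (∀ i, T i)) {i i' : Fin k}
    (h : (factorSubgroup T i).map (MulEquiv.toMonoidHom g) = factorSubgroup T i') :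
    ∃ φ : T i ≃* T i', ∀ f, g f i' = φ (f i) := by
  have hmem (t : T i) : g (Pi.mulSingle i t) ∈ factorSubgroup T i' :=
    h ▸ Subgroup.mem_map_of_mem (MulEquiv.toMonoidHom g) (mulSingle_mem_factorSubgroup i t)
  have hsurj (x : T i') : ∃ t : T i, g (Pi.mulSingle i t) = Pi.mulSingle i' x := by
    have hx := mulSingle_mem_factorSubgroup i' x
    rw [← h] at hx
    obtain ⟨f, hf, hfx⟩ := hx
    exact ⟨f i, by rw [mulSingle_apply_of_mem_factorSubgroup hf]; exact hfx⟩
  let ψ : T i →* T i' :=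
    (Pi.evalMonoidHom T i').comp ((MulEquiv.toMonoidHom g).comp (MonoidHom.mulSingle T i))
  have hψ (t : T i) : ψ t = g (Pi.mulSingle i t) i' := rfl
  have hbij : Function.Bijective ψ := by
    refine ⟨fun s t hst => ?_, fun x => ?_⟩
    · rw [hψ, hψ] at hst
      have := congrArg (Pi.mulSingle (M := T) i') hst
      rw [mulSingle_apply_of_mem_factorSubgroup (hmem s),
        mulSingle_apply_of_mem_factorSubgroup (hmem t)] at this
      exact Pi.mulSingle_injective i (g.injective this)
    · obtain ⟨t, ht⟩ := hsurj x
      exact ⟨t, by rw [hψ, ht, Pi.mulSingle_eq_same]⟩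
  refine ⟨MulEquiv.ofBijective ψ hbij, fun f => ?_⟩
  have hone : g ((Pi.mulSingle i (f i))⁻¹ * f) i' = 1 := by
    refine IsSimpleGroup.eq_one_of_forall_commute (hnonab i') fun x => ?_
    obtain ⟨t, ht⟩ := hsurj x
    have hcomm : Pi.mulSingle i t * ((Pi.mulSingle i (f i))⁻¹ * f) =
        ((Pi.mulSingle i (f i))⁻¹ * f) * Pi.mulSingle i t := by
      funext j
      by_cases hj : j = i
      · subst hj
        simp
      · simp [Pi.mulSingle_eq_of_ne hj]
    have := congrFun (congrArg g hcomm) i'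
    simpa only [map_mul g, ht, Pi.mul_apply, Pi.mulSingle_eq_same] using this
  rw [map_mul, map_inv, Pi.mul_apply, Pi.inv_apply, inv_mul_eq_one] at hone
  exact hone.symm

theorem CoordsLinked.map [∀ i, IsSimpleGroup (T i)]
    (hnonab : ∀ i, ∃ a b : T i, a * b ≠ b * a) (g : MulAut (∀ i, T i)) {i i' j j' : Fin k}
    (hi : (factorSubgroup T i).map (MulEquiv.toMonoidHom g) = factorSubgroup T i')
    (hj : (factorSubgroup T j).map (MulEquiv.toMonoidHom g) = factorSubgroup T j')
    {K : Subgroup (∀ i, T i)} (h : CoordsLinked K i j) :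
    CoordsLinked (K.map (MulEquiv.toMonoidHom g)) i' j' := by
  obtain ⟨φ, hφ⟩ := exists_mulEquiv_apply_eq hnonab g hi
  obtain ⟨ψ, hψ⟩ := exists_mulEquiv_apply_eq hnonab g hj
  obtain ⟨χ, hχ⟩ := h
  refine ⟨(φ.symm.trans χ).trans ψ, ?_⟩
  rintro _ ⟨f, hf, rfl⟩
  change g f j' = ψ (χ (φ.symm (g f i')))
  rw [hφ, hψ, φ.symm_apply_apply, hχ f hf]

/-- The members of an abstract cartesian factorisation are pairwise distinct. -/
theorem injective_of_cartesian {M : Type*} [Group M] {ℓ : ℕ} {K : Fin ℓ → Subgroup M}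
    (hproper : ∀ m, K m ≠ ⊤)
    (hcart : ∀ m, (K m : Set M) * ((⨅ j ≠ m, K j : Subgroup M) : Set M) = Set.univ) :
    Function.Injective K := by
  intro m m' hK
  by_contra hne
  refine hproper m (eq_top_iff.mpr fun x _ => ?_)
  obtain ⟨a, ha, b, hb, rfl⟩ : x ∈ (K m : Set M) * ((⨅ j ≠ m, K j : Subgroup M) : Set M) :=
    hcart m ▸ Set.mem_univ x
  have hle : (⨅ j ≠ m, K j) ≤ K m' := iInf₂_le (f := fun j (_ : j ≠ m) => K j) m' (Ne.symm hne)
  rw [← hK] at hle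
  exact mul_mem ha (hle hb)

/-- Suppose `i` and `j` are distinct coordinates linked by `K m`, and that they are also joined
by a chain of links that never uses the class of `i` under `K m`. Then `T j` has a uniform
automorphism, and the intersection of the `K m` does not project onto `T i`. -/
theorem uniform_and_not_surjective_of_chain [∀ i, Nontrivial (T i)] {ℓ : ℕ}
    {K : Fin ℓ → Subgroup (∀ i, T i)}
    (hcart : ∀ m, (K m : Set (∀ i, T i)) *
        ((⨅ j ≠ m, K j : Subgroup (∀ i, T i)) : Set (∀ i, T i)) = Set.univ)
    {m : Fin ℓ} {i j : Fin k} (hij : i ≠ j) (hlink : CoordsLinked (K m) i j)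
    (hchain : Relation.ReflTransGen
      (fun a b => ∃ m', CoordsLinked (K m') a b ∧ (m' = m → ¬ CoordsLinked (K m) i a)) i j) :
    (∃ α : T j ≃* T j, Function.Surjective fun t => t⁻¹ * α t) ∧
      Subgroup.map (Pi.evalMonoidHom T i) (⨅ m, K m) ≠ ⊤ := by
  let L : Set (∀ i, T i) := {y | (∀ m', m' ≠ m → y ∈ K m') ∧
    ∃ x ∈ K m, ∀ a, ¬ CoordsLinked (K m) i a → y a = x a}
  have hL : ∃ α : T i ≃* T j, ∀ y ∈ L, y j = α (y i) := by
    clear hij hlink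
    induction hchain with
    | refl => exact ⟨MulEquiv.refl _, fun _ _ => rfl⟩
    | @tail b c _ hbc ih =>
      obtain ⟨α, hα⟩ := ih
      obtain ⟨m', hlink', hm'⟩ := hbc
      have hlink'' := hlink'
      obtain ⟨φ, hφ⟩ := hlink'
      refine ⟨α.trans φ, fun y hy => ?_⟩
      rw [MulEquiv.trans_apply, ← hα y hy]
      by_cases h : m' = m
      · subst h
        obtain ⟨x, hx, hyx⟩ := hy.2
        have hb := hm' rfl
        rw [hyx b hb, hyx c fun hc => hb (hc.trans hlink''.symm), hφ x hx]
      · exact hφ y (hy.1 m' h)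
  obtain ⟨α, hα⟩ := hL
  obtain ⟨φ, hφ⟩ := hlink
  have hunif : Function.Surjective fun t => t⁻¹ * (φ.symm.trans α) t := by
    intro c
    obtain ⟨x, hx, y, hy, hxy⟩ : Pi.mulSingle j c ∈
        (K m : Set (∀ i, T i)) * ((⨅ j ≠ m, K j : Subgroup (∀ i, T i)) : Set (∀ i, T i)) :=
      hcart m ▸ Set.mem_univ _
    have hy' : y = x⁻¹ * Pi.mulSingle j c := eq_inv_mul_of_mul_eq hxy
    have hyL : y ∈ L := by
      refine ⟨fun m' hm' => (iInf₂_le m' hm' : (⨅ j ≠ m, K j) ≤ K m') hy,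
        x⁻¹, inv_mem hx, fun a ha => ?_⟩
      have haj : a ≠ j := by
        rintro rfl
        exact ha ⟨φ, hφ⟩
      simp [hy', Pi.mulSingle_eq_of_ne haj]
    have h := hα y hyL
    refine ⟨(x j)⁻¹, ?_⟩
    simp only [hy', Pi.mul_apply, Pi.inv_apply, Pi.mulSingle_eq_same,
      Pi.mulSingle_eq_of_ne hij, mul_one, map_inv, inv_mul_eq_iff_eq_mul] at h
    simp [hφ x hx, h]
  refine ⟨⟨_, hunif⟩, fun htop => ?_⟩
  have heq (t : T i) : φ t = α t := by
    obtain ⟨y, hy, rfl⟩ : t ∈ Subgroup.map (Pi.evalMonoidHom T i) (⨅ m, K m) :=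
      htop ▸ Subgroup.mem_top t
    have hyK (m') : y ∈ K m' := iInf_le K m' hy
    exact (hφ y (hyK m)).symm.trans (hα y ⟨fun m' _ => hyK m', y, hyK m, fun _ _ => rfl⟩)
  obtain ⟨c, hc⟩ := exists_ne (1 : T j)
  obtain ⟨t, rfl⟩ := hunif c
  simp [← heq] at hc

end Strips

/-- Proposition (mainstripfact): let `M = T₁ × ⋯ × T_k` with the `T i` pairwise
isomorphic nonabelian simple groups, `G₀ ≤ Aut M` acting transitively on the set of
direct factors, and `𝒦 = {K₁,…,K_ℓ}` a `G₀`-invariant abstract cartesian factorisation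
of `M`; set `M₀ = ⋂ K_i`.  If there are two distinct nontrivial full strips `X₁ ≠ X₂`
involved in members of `𝒦` with intersecting supports, then `T₁` admits a uniform
automorphism and `M₀` is not a subdirect subgroup of `M`. -/
theorem mainstripfact {k ℓ : ℕ} (hk : 0 < k) (T : Fin k → Type*) [∀ i, Group (T i)]
    [∀ i, IsSimpleGroup (T i)]
    (hnonab : ∀ i, ∃ a b : T i, a * b ≠ b * a)
    (hiso : ∀ i j, Nonempty (T i ≃* T j))
    (G₀ : Subgroup (MulAut (∀ i, T i)))
    (hperm : ∀ g ∈ G₀, ∀ i, ∃ j,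
      (factorSubgroup T i).map (MulEquiv.toMonoidHom g) = factorSubgroup T j)
    (htrans : ∀ i j, ∃ g ∈ G₀,
      (factorSubgroup T i).map (MulEquiv.toMonoidHom g) = factorSubgroup T j)
    (K : Fin ℓ → Subgroup (∀ i, T i))
    (hproper : ∀ m, K m ≠ ⊤)
    (hcart : ∀ m, (K m : Set (∀ i, T i)) *
        ((⨅ j ≠ m, K j : Subgroup (∀ i, T i)) : Set (∀ i, T i)) = Set.univ)
    (hinv : ∀ g ∈ G₀, ∀ m, ∃ m', (K m).map (MulEquiv.toMonoidHom g) = K m')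
    (X₁ X₂ : Subgroup (∀ i, T i)) (S₁ S₂ : Finset (Fin k))
    (h1 : IsFullStrip T X₁ S₁) (h2 : IsFullStrip T X₂ S₂)
    (hn1 : 2 ≤ S₁.card) (hn2 : 2 ≤ S₂.card)
    (hne : X₁ ≠ X₂)
    (hi1 : ∃ m, StripInvolvedIn T X₁ (K m) S₁)
    (hi2 : ∃ m, StripInvolvedIn T X₂ (K m) S₂)
    (hmeet : (S₁ ∩ S₂).Nonempty) :
    (∃ α : T ⟨0, hk⟩ ≃* T ⟨0, hk⟩, Function.Surjective fun t => t⁻¹ * α t) ∧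
      ¬ ∀ i, Subgroup.map (Pi.evalMonoidHom T i) (⨅ m, K m) = ⊤ := by
  have hinj := injective_of_cartesian hproper hcart
  obtain ⟨i, hi⟩ := hmeet
  obtain ⟨hi₁, hi₂⟩ := Finset.mem_inter.mp hi
  obtain ⟨m₁, hm₁⟩ := hi1
  obtain ⟨m₂, hm₂⟩ := hi2
  have hm : m₁ ≠ m₂ := by
    rintro rfl
    exact hne (hm₁.strip_eq hm₂ h1 h2 hi₁ hi₂)
  obtain ⟨j₁, hj₁, hne₁⟩ := Finset.exists_mem_ne (by omega : 1 < S₁.card) i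
  obtain ⟨j₂, hj₂, hne₂⟩ := Finset.exists_mem_ne (by omega : 1 < S₂.card) i
  have hlink₁ := hm₁.coordsLinked h1 hi₁ hj₁
  have hlink₂ := hm₂.coordsLinked h2 hi₂ hj₂
  have htransport : ∀ v, ∀ g ∈ G₀,
      (factorSubgroup T i).map (MulEquiv.toMonoidHom g) = factorSubgroup T v →
      ∀ m j, j ≠ i → CoordsLinked (K m) i j →
        ∃ m' j', (K m).map (MulEquiv.toMonoidHom g) = K m' ∧ j' ≠ v ∧
          CoordsLinked (K m') v j' := by
    intro v g hg hgv m j hji hlink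
    obtain ⟨j', hj'⟩ := hperm g hg j
    obtain ⟨m', hm'⟩ := hinv g hg m
    refine ⟨m', j', hm', ?_, hm' ▸ hlink.map hnonab g hgv hj'⟩
    rintro rfl
    exact hji (factorSubgroup_injective
      (Subgroup.map_injective (MulEquiv.injective g) (hj'.trans hgv.symm)))
  have htwo : ∀ v, ∃ m m', m ≠ m' ∧ (∃ j, j ≠ v ∧ CoordsLinked (K m) v j) ∧
      ∃ j, j ≠ v ∧ CoordsLinked (K m') v j := by
    intro v
    obtain ⟨g, hg, hgv⟩ := htrans i v
    obtain ⟨m, j, hKm, hj⟩ := htransport v g hg hgv m₁ j₁ hne₁ hlink₁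
    obtain ⟨m', j', hKm', hj'⟩ := htransport v g hg hgv m₂ j₂ hne₂ hlink₂
    refine ⟨m, m', ?_, ⟨j, hj⟩, j', hj'⟩
    rintro rfl
    exact hm (hinj (Subgroup.map_injective (MulEquiv.injective g) (hKm.trans hKm'.symm)))
  let inc (v : Fin k) (e : Fin ℓ × Set (Fin k)) : Prop :=
    e.2 = {l | CoordsLinked (K e.1) v l} ∧ ∃ j, j ≠ v ∧ CoordsLinked (K e.1) v j
  obtain ⟨⟨m, B⟩, a, b, hab, ha, hb, hchain⟩ :=
    exists_joined_by_other_edges inc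
      (by
        intro v e
        obtain ⟨m, m', hmm', hj, hj'⟩ := htwo v
        by_cases he : m = e.1
        · exact ⟨(m', {l | CoordsLinked (K m') v l}),
            fun h => hmm' (he.trans (congrArg Prod.fst h).symm), rfl, hj'⟩
        · exact ⟨(m, {l | CoordsLinked (K m) v l}), fun h => he (congrArg Prod.fst h), rfl, hj⟩)
      (by
        rintro v ⟨m, B⟩ ⟨hB, j, hj, hlink⟩
        exact ⟨j, hj, hB.trans hlink.setOf_eq, v, hj.symm, hlink.symm⟩)
      i (m₁, ∅)
  have hlinked {m : Fin ℓ} {B : Set (Fin k)} {v w : Fin k} (hv : inc v (m, B))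
      (hw : inc w (m, B)) : CoordsLinked (K m) v w := by
    have : w ∈ {l | CoordsLinked (K m) v l} := by
      rw [← show B = _ from hv.1, show B = _ from hw.1]
      exact CoordsLinked.refl _ _
    exact this
  obtain ⟨⟨α, hα⟩, hsub⟩ := uniform_and_not_surjective_of_chain hcart hab (hlinked ha hb)
    (Relation.ReflTransGen.mono (by
      rintro p q ⟨⟨m', B'⟩, hne', hp, hq⟩
      refine ⟨m', hlinked hp hq, ?_⟩
      rintro rfl hap
      exact hne' (Prod.ext rfl (hp.1.trans (hap.setOf_eq.symm.trans ha.1.symm))))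
      _ _ hchain)
  refine ⟨?_, fun h => hsub (h a)⟩
  obtain ⟨θ⟩ := hiso b ⟨0, hk⟩
  refine ⟨(θ.symm.trans α).trans θ, fun c => ?_⟩
  obtain ⟨t, ht⟩ := hα (θ.symm c)
  refine ⟨θ t, ?_⟩
  have ht' : t⁻¹ * α t = θ.symm c := ht
  simp [← map_inv, ← map_mul, ht']
end

section
/- Let M = T₁×⋯×T_k be a direct product of pairwise isomorphic nonabelian simple groups and let 𝒦 = {K₁,…,K_ℓ} be an abstract cartesian factorisation of M. Let X₁ and X₂ be nontrivial full strips with X₁ involved in K₁ and X₂ involved in K₂, where K₁ ≠ K₂. Assume that either T₁ does not admit a uniform automorphism, or that M₀ = K₁ ∩ ⋯ ∩ K_ℓ is a subdirect subgroup of M. Then |Supp X₁ ∩ Supp X₂| ≤ 1. -/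
open scoped Pointwise

/-- If a full strip `X` is involved in `K`, then any two coordinates in its support are
related, on `K`, by a fixed isomorphism. -/
theorem exists_mulEquiv_of_stripInvolvedIn {k : ℕ} {T : Fin k → Type*} [∀ i, Group (T i)]
    {X K : Subgroup (∀ i, T i)} {S : Finset (Fin k)}
    (hX : IsFullStrip T X S) (hK : StripInvolvedIn T X K S) {i j : Fin k}
    (hi : i ∈ S) (hj : j ∈ S) : ∃ α : T i ≃* T j, ∀ g ∈ K, g j = α (g i) := by
  obtain ⟨i₀, -, φ, -, hXeq⟩ := hX
  refine ⟨(φ i).symm.trans (φ j), fun g hg => ?_⟩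
  have hgK : g ∈ (K : Set (∀ i, T i)) := hg
  rw [hK] at hgK
  have hgX : (fun i => if i ∈ S then g i else 1) ∈ (X : Set (∀ i, T i)) := hgK.1
  rw [hXeq] at hgX
  obtain ⟨t, ht⟩ := hgX
  have hti := (ht i).1 hi
  have htj := (ht j).1 hj
  simp only [hi, hj, if_true] at hti htj
  simp [hti, htj]

/-- If `K` and `L` factorise `M`, and the coordinates `i ≠ j` are related by `α` on `K` and
by `β` on `L`, then `α⁻¹ ∘ β` is a uniform automorphism of `T i`. -/
theorem uniform_of_mul_eq_univ {ι : Type*} {T : ι → Type*} [∀ i, Group (T i)]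
    {K L : Subgroup (∀ i, T i)}
    (hKL : (K : Set (∀ i, T i)) * (L : Set (∀ i, T i)) = Set.univ)
    {i j : ι} (hij : i ≠ j) {α β : T i ≃* T j}
    (hα : ∀ g ∈ K, g j = α (g i)) (hβ : ∀ g ∈ L, g j = β (g i)) :
    Function.Surjective fun t => t⁻¹ * β.trans α.symm t := by
  classical
  intro b
  have hmem : Pi.mulSingle j (α b) ∈ (K : Set (∀ i, T i)) * (L : Set (∀ i, T i)) :=
    hKL ▸ Set.mem_univ _
  obtain ⟨x, hx, y, hy, hxy⟩ := Set.mem_mul.mp hmem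
  have hxyi : x i * y i = 1 := by
    simpa [Pi.mulSingle_eq_of_ne hij] using congrFun hxy i
  have hxyj : α (x i) * β (y i) = α b := by
    simpa [hα x hx, hβ y hy] using congrFun hxy j
  refine ⟨y i, α.injective ?_⟩
  simp [← hxyj, eq_inv_of_mul_eq_one_left hxyi]

/-- A uniform automorphism can be transported along an isomorphism. -/
theorem uniform_conj {G H : Type*} [Group G] [Group H] (e : G ≃* H) {γ : G ≃* G}
    (hγ : Function.Surjective fun t => t⁻¹ * γ t) :
    Function.Surjective fun t => t⁻¹ * (e.symm.trans (γ.trans e)) t := by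
  intro b
  obtain ⟨t, ht⟩ := hγ (e.symm b)
  refine ⟨e t, e.symm.injective ?_⟩
  simpa using ht

/-- Claim 1 of the proof of the main strip-factorisation proposition: let
`M = T₁ × ⋯ × T_k` with the `T i` pairwise isomorphic nonabelian simple groups and
`𝒦 = {K₁,…,K_ℓ}` an abstract cartesian factorisation of `M`.  Let `X₁, X₂` be
nontrivial full strips involved in distinct members `K m₁ ≠ K m₂` of `𝒦`.  If either
`T₁` admits no uniform automorphism or `M₀ = ⋂ K_i` is a subdirect subgroup of `M`,
then `|Supp X₁ ∩ Supp X₂| ≤ 1`. -/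
theorem strips_intersect_in_at_most_one_factor {k ℓ : ℕ} (hk : 0 < k)
    (T : Fin k → Type*) [∀ i, Group (T i)] [∀ i, IsSimpleGroup (T i)]
    (hnonab : ∀ i, ∃ a b : T i, a * b ≠ b * a)
    (hiso : ∀ i j, Nonempty (T i ≃* T j))
    (K : Fin ℓ → Subgroup (∀ i, T i))
    (hproper : ∀ m, K m ≠ ⊤)
    (hcart : ∀ m, (K m : Set (∀ i, T i)) *
        ((⨅ j ≠ m, K j : Subgroup (∀ i, T i)) : Set (∀ i, T i)) = Set.univ)
    (m₁ m₂ : Fin ℓ) (hKne : K m₁ ≠ K m₂)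
    (X₁ X₂ : Subgroup (∀ i, T i)) (S₁ S₂ : Finset (Fin k))
    (h1 : IsFullStrip T X₁ S₁) (h2 : IsFullStrip T X₂ S₂)
    (hn1 : 2 ≤ S₁.card) (hn2 : 2 ≤ S₂.card)
    (hi1 : StripInvolvedIn T X₁ (K m₁) S₁)
    (hi2 : StripInvolvedIn T X₂ (K m₂) S₂)
    (halt : (∀ α : T ⟨0, hk⟩ ≃* T ⟨0, hk⟩, ¬ Function.Surjective fun t => t⁻¹ * α t) ∨
      ∀ i, Subgroup.map (Pi.evalMonoidHom T i) (⨅ m, K m) = ⊤) :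
    (S₁ ∩ S₂).card ≤ 1 := by
  by_contra hcard
  obtain ⟨i, hi, j, hj, hij⟩ := Finset.one_lt_card.mp (not_le.mp hcard)
  rw [Finset.mem_inter] at hi hj
  obtain ⟨α, hα⟩ := exists_mulEquiv_of_stripInvolvedIn h1 hi1 hi.1 hj.1
  obtain ⟨β, hβ⟩ := exists_mulEquiv_of_stripInvolvedIn h2 hi2 hi.2 hj.2
  have hm : m₂ ≠ m₁ := fun h => hKne (h ▸ rfl)
  have hunif := uniform_of_mul_eq_univ (hcart m₁) hij hα
    fun g hg => hβ g (iInf₂_le (f := fun j (_ : j ≠ m₁) => K j) m₂ hm hg)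
  rcases halt with hno | hsub
  · obtain ⟨e⟩ := hiso i ⟨0, hk⟩
    exact hno _ (uniform_conj e hunif)
  · have hαβ : ∀ t, α t = β t := fun t => by
      have ht : t ∈ Subgroup.map (Pi.evalMonoidHom T i) (⨅ m, K m) := hsub i ▸ Subgroup.mem_top t
      obtain ⟨g, hg, rfl⟩ := ht
      exact (hα g (iInf_le K m₁ hg)).symm.trans (hβ g (iInf_le K m₂ hg))
    obtain ⟨b, hb⟩ := exists_ne (1 : T i)
    obtain ⟨t, ht⟩ := hunif b
    exact hb (by simpa [← hαβ] using ht.symm)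
end
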